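/- For n, m ≥ 1, the three subsets SH^≻(n,m) := {γ ∈ SH(n,m) : γ(n) < γ(n+m)}, SH^•(n,m) := {γ ∈ SH(n,m) : γ(n) = γ(n+m)} and SH^≺(n,m) := {γ ∈ SH(n,m) : γ(n) > γ(n+m)} are described in terms of the weak Bruhat order ≤_B on P_{n+m} as follows: (1) SH^≻(n,m) = {γ ∈ P_{n+m} : γ ≤_B ξ_{n,m−1}×1₁}; (2) SH^•(n,m) = {γ ∈ P_{n+m} : z(n−1,m−1,0) ≤_B γ ≤_B (ξ_{n−1,m−1}×1₁)∘z(n−1,m−1,0)}; (3) SH^≺(n,m) = {γ ∈ P_{n+m} : z(n−1,m) ≤_B γ ≤_B ξ_{n,m}}, where z(n−1,m−1,0) := (1,…,n−1, n+m−1, n,…,n+m−1) ∈ P_{n+m,n+m−1} and z(n−1,m) := (1,…,n−1, n+m, n,…,n+m−1) ∈ P_{n+m,n+m}. -/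

import Mathlib

namespace PaperP

/-- `IsPF n r f` : `f` represents a surjective map `{1,…,n} → {1,…,r}` (an element of
`P_{n,r}`), normalized so that `f v = 0` for `v ∉ {1,…,n}`. -/
def IsPF (n r : ℕ) (f : ℕ → ℕ) : Prop :=
  (∀ v : ℕ, f v ≠ 0 ↔ (1 ≤ v ∧ v ≤ n)) ∧ f '' Set.Icc 1 n = Set.Icc 1 r

/-- The product `γ × δ ∈ P_{n+m,r+s}` of `γ ∈ P_{n,r}` and `δ ∈ P_{m,s}`:
`(γ×δ)(i) = γ(i)` for `1 ≤ i ≤ n` and `(γ×δ)(n+i) = δ(i)+r` for `1 ≤ i ≤ m`. -/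
def prodF (n r : ℕ) (f g : ℕ → ℕ) : ℕ → ℕ := fun v =>
  if v ≤ n then f v else if g (v - n) = 0 then 0 else g (v - n) + r

/-- The identity map `1_r` of `{1,…,r}`. -/
def idF (r : ℕ) : ℕ → ℕ := fun v => if 1 ≤ v ∧ v ≤ r then v else 0

/-- The map `t_i ∈ P_{r,r-1}` : `t_i(j) = j` for `j ≤ i` and `t_i(j) = j-1` for `j > i`. -/
def tF (r i : ℕ) : ℕ → ℕ := fun v =>
  if 1 ≤ v ∧ v ≤ r then (if v ≤ i then v else v - 1) else 0

/-- The block-increasing condition: `γ` is increasing on each of the consecutive blocks of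
sizes `ns = (n₁,…,n_r)` (positions are 1-based). -/
def BlockIncr (ns : List ℕ) (f : ℕ → ℕ) : Prop :=
  ∀ j < ns.length, ∀ a b : ℕ, (ns.take j).sum < a → a < b → b ≤ (ns.take (j + 1)).sum →
    f a < f b

/-- Membership in the set of shuffles `SH(n₁,…,n_r) ⊆ P_n`, `n = n₁+…+n_r`. -/
def InSH (ns : List ℕ) (f : ℕ → ℕ) : Prop :=
  (∃ r : ℕ, IsPF ns.sum r f) ∧ BlockIncr ns f

/-- `γ⁻¹(i) < γ⁻¹(i+1)` : every element of `γ⁻¹(i)` is smaller than every element of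
`γ⁻¹(i+1)`. -/
def InvIncr (f : ℕ → ℕ) (i : ℕ) : Prop := ∀ a b : ℕ, f a = i → f b = i + 1 → a < b

/-- `γ⁻¹(i) > γ⁻¹(i+1)` : every element of `γ⁻¹(i)` is larger than every element of
`γ⁻¹(i+1)`. -/
def InvDecr (f : ℕ → ℕ) (i : ℕ) : Prop := ∀ a b : ℕ, f a = i → f b = i + 1 → b < a

/-- One covering step of the weak Bruhat order on `P_n` :
`γ <_B t_i ∘ γ` when `γ⁻¹(i) < γ⁻¹(i+1)`, and `t_i ∘ γ <_B γ` when `γ⁻¹(i) > γ⁻¹(i+1)`,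
for `γ ∈ P_{n,r}` and `1 ≤ i ≤ r-1`. -/
def BStep (n : ℕ) (f g : ℕ → ℕ) : Prop :=
  ∃ r i : ℕ, 1 ≤ i ∧ i + 1 ≤ r ∧
    ((IsPF n r f ∧ InvIncr f i ∧ g = tF r i ∘ f) ∨
     (IsPF n r g ∧ InvDecr g i ∧ f = tF r i ∘ g))

/-- The weak Bruhat order `≤_B` on `P_n`, the reflexive-transitive closure of `BStep`. -/
def BLE (n : ℕ) : (ℕ → ℕ) → (ℕ → ℕ) → Prop := Relation.ReflTransGen (BStep n)

/-- Turn a (1-based) list of values into a normalized map `ℕ → ℕ`. -/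
def ofList (l : List ℕ) : ℕ → ℕ := fun v => if v = 0 then 0 else l.getD (v - 1) 0

/-- The maximal shuffle `ξ_{n₁,…,n_r}` :
`ξ(k) = k - (n₁+…+n_{j-1}) + (n_{j+1}+…+n_r)` for `n₁+…+n_{j-1} < k ≤ n₁+…+n_j`. -/
def xiF : List ℕ → ℕ → ℕ
  | [], _ => 0
  | m :: rest, k =>
      if k = 0 then 0 else if k ≤ m then k + rest.sum else xiF rest (k - m)

/-- The list `z(n₀,…,n_k) = (1,…,n₀, n+1, n₀+1,…,n₀+n₁, n+1, …, n+1, n₀+…+n_{k-1}+1,…,n)`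
where `n = n₀+…+n_k` (built with an accumulator `start`). -/
def zList (n : ℕ) : ℕ → List ℕ → List ℕ
  | _, [] => []
  | start, [m] => List.range' (start + 1) m
  | start, m :: rest => List.range' (start + 1) m ++ (n + 1) :: zList n (start + m) rest

/-- `z(n₀,…,n_k)` as a normalized map. -/
def zF (ns : List ℕ) : ℕ → ℕ := ofList (zList ns.sum 0 ns)

/-- The iterated product `γ₀ × … × γ_k` of a family, each member given as a triple
`(nᵢ, rᵢ, γᵢ)` with `γᵢ ∈ P_{nᵢ,rᵢ}`; returns `(Σnᵢ, Σrᵢ, γ₀×…×γ_k)`. -/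
def prodFam : List (ℕ × ℕ × (ℕ → ℕ)) → ℕ × ℕ × (ℕ → ℕ)
  | [] => (0, 0, fun _ => 0)
  | (n, r, f) :: rest =>
      let p := prodFam rest
      (n + p.1, r + p.2.1, prodF n r f p.2.2)

/-- The wedge `⋁_ω(γ₀,…,γ_k) = ((ω ∘ (γ₀×…×γ_k)) × 1₁) ∘ z(n₀,…,n_k)` of a family
`γᵢ ∈ P_{nᵢ,rᵢ}` over a shuffle `ω ∈ SH(r₀,…,r_k)`. -/
def wedgeF (ω : ℕ → ℕ) (fam : List (ℕ × ℕ × (ℕ → ℕ))) : ℕ → ℕ :=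
  prodF (prodFam fam).1 (prodFam fam).2.1 (ω ∘ (prodFam fam).2.2) (idF 1) ∘
    zF (fam.map (·.1))

theorem isPF_iff {n r : ℕ} {f : ℕ → ℕ} :
    IsPF n r f ↔ (∀ v, f v ≠ 0 ↔ (1 ≤ v ∧ v ≤ n)) ∧ (∀ v, f v ≤ r) ∧
      ∀ k, 1 ≤ k → k ≤ r → ∃ v, f v = k := by
  constructor
  · rintro ⟨h0, h⟩
    refine ⟨h0, fun v => ?_, fun k hk hkr => ?_⟩
    · by_cases hv : f v = 0
      · omega
      · have : f v ∈ Set.Icc 1 r := h ▸ ⟨v, (h0 v).1 hv, rfl⟩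
        exact this.2
    · have : k ∈ f '' Set.Icc 1 n := h ▸ ⟨hk, hkr⟩
      obtain ⟨v, -, hv⟩ := this
      exact ⟨v, hv⟩
  · rintro ⟨h0, h1, h2⟩
    refine ⟨h0, Set.ext fun k => ⟨?_, ?_⟩⟩
    · rintro ⟨v, hv, rfl⟩
      exact ⟨Nat.one_le_iff_ne_zero.2 ((h0 v).2 hv), h1 v⟩
    · rintro ⟨hk, hkr⟩
      obtain ⟨v, rfl⟩ := h2 k hk hkr
      exact ⟨v, (h0 v).1 (by omega), rfl⟩

theorem blockIncr_pair_iff {n m : ℕ} {f : ℕ → ℕ} :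
    BlockIncr [n, m] f ↔ (∀ a b, 1 ≤ a → a < b → b ≤ n → f a < f b) ∧
      ∀ a b, n < a → a < b → b ≤ n + m → f a < f b := by
  constructor
  · intro h
    exact ⟨fun a b ha hab hb => h 0 (by simp) a b (by simpa using Nat.succ_le_iff.1 ha) hab (by simpa using hb),
      fun a b ha hab hb => h 1 (by simp) a b (by simpa using ha) hab (by simpa using hb)⟩
  · rintro ⟨h1, h2⟩ j hj a b ha hab hb
    have hj' : j < 2 := hj
    interval_cases j
    · exact h1 a b (Nat.succ_le_iff.2 (by simpa using ha)) hab (by simpa using hb)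
    · exact h2 a b (by simpa using ha) hab (by simpa using hb)

theorem tF_of_le {r i v : ℕ} (hv : v ≤ r) : tF r i v = if v ≤ i then v else v - 1 := by
  unfold tF
  split_ifs <;> omega

/-- Going up in the weak Bruhat order can only turn `γ a < γ b` into `γ a = γ b` and
`γ a = γ b` into `γ a > γ b`, for positions `a < b`. -/
theorem BLE.descents {n : ℕ} {f g : ℕ → ℕ} (h : BLE n f g) {a b : ℕ} (hab : a < b) :
    (f b ≤ f a → g b ≤ g a) ∧ (f b < f a → g b < g a) := by
  induction h with
  | refl => exact ⟨id, id⟩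
  | @tail g g' _ hs ih =>
    suffices (g b ≤ g a → g' b ≤ g' a) ∧ (g b < g a → g' b < g' a) from
      ⟨fun h => this.1 (ih.1 h), fun h => this.2 (ih.2 h)⟩
    obtain ⟨r, i, hi, hir, ⟨hP, hI, rfl⟩ | ⟨hP, hD, rfl⟩⟩ := hs
    · have h1 := (isPF_iff.1 hP).2.1
      have h2 := hI b a
      simp only [Function.comp_apply, tF_of_le (h1 _)]
      split_ifs <;> omega
    · have h1 := (isPF_iff.1 hP).2.1
      have h2 := hD a b
      simp only [Function.comp_apply, tF_of_le (h1 _)]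
      split_ifs <;> omega

theorem BLE.blockIncr {n m : ℕ} {f g : ℕ → ℕ} (h : BLE (n + m) f g)
    (hg : BlockIncr [n, m] g) : BlockIncr [n, m] f := by
  rw [blockIncr_pair_iff] at hg ⊢
  refine ⟨fun a b ha hab hb => ?_, fun a b ha hab hb => ?_⟩
  · have := hg.1 a b ha hab hb
    have := (h.descents hab).1
    omega
  · have := hg.2 a b ha hab hb
    have := (h.descents hab).1
    omega

theorem IsPF.le_of_strictMono {N s t : ℕ} {f g : ℕ → ℕ} (hf : IsPF N s f) (hg : IsPF N t g)
    (h : ∀ v w, 1 ≤ v → v ≤ N → 1 ≤ w → w ≤ N → f v < f w → g v < g w) (v : ℕ) :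
    f v ≤ g v := by
  rw [isPF_iff] at hf hg
  induction hk : f v using Nat.strong_induction_on generalizing v with
  | _ k ih =>
    subst hk
    by_cases h0 : f v = 0
    · omega
    have hv := (hf.1 v).1 h0
    by_cases h1 : f v = 1
    · have := (hg.1 v).2 hv
      omega
    · have := hf.2.1 v
      obtain ⟨w, hw⟩ := hf.2.2 (f v - 1) (by omega) (by omega)
      have hw' := (hf.1 w).1 (by omega)
      have h2 := h w v hw'.1 hw'.2 hv.1 hv.2 (by omega)
      have h3 := ih (f w) (by omega) w rfl
      omega

/-- Two-block shuffles are comparable in the weak Bruhat order as soon as the relative order of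
any two positions from distinct blocks is compatible. -/
theorem BLE.of_cross {n m : ℕ} {t : ℕ} {g : ℕ → ℕ} (hg : IsPF (n + m) t g)
    (hgB : BlockIncr [n, m] g) {s : ℕ} {f : ℕ → ℕ} (hf : IsPF (n + m) s f)
    (hfB : BlockIncr [n, m] f)
    (hc : ∀ a b, 1 ≤ a → a ≤ n → n < b → b ≤ n + m →
      (f b ≤ f a → g b ≤ g a) ∧ (f b < f a → g b < g a)) :
    BLE (n + m) f g := by
  induction hM : ∑ p ∈ Finset.Icc 1 n ×ˢ Finset.Icc (n + 1) (n + m),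
    ((if f p.1 < f p.2 then 1 else 0) + (if f p.1 ≤ f p.2 then 1 else 0))
    using Nat.strong_induction_on generalizing f s with
  | _ M ih =>
  subst hM
  have hg' := isPF_iff.1 hg
  have hf' := isPF_iff.1 hf
  rw [blockIncr_pair_iff] at hgB hfB
  have inj1 : ∀ c d, 1 ≤ c → c ≤ n → 1 ≤ d → d ≤ n → f c = f d → c = d := by
    intro c d _ _ _ _ h
    have h1 := hfB.1 c d
    have h2 := hfB.1 d c
    omega
  have inj2 : ∀ c d, n < c → c ≤ n + m → n < d → d ≤ n + m → f c = f d → c = d := by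
    intro c d _ _ _ _ h
    have h1 := hfB.2 c d
    have h2 := hfB.2 d c
    omega
  -- It suffices to find an upward step which does not overtake `g`.
  have step : ∀ f' s' a b, 1 ≤ a → a ≤ n → n < b → b ≤ n + m → BStep (n + m) f f' →
      IsPF (n + m) s' f' → BlockIncr [n, m] f' →
      (∀ a b, 1 ≤ a → a ≤ n → n < b → b ≤ n + m →
        (f' b ≤ f' a → g b ≤ g a) ∧ (f' b < f' a → g b < g a)) →
      (f a = f b ∧ f' b < f' a ∨ f a < f b ∧ f' b ≤ f' a) → BLE (n + m) f g := by
    intro f' s' a b ha han hb hbm hs hP hB hc' hab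
    refine Relation.ReflTransGen.head hs (ih _ ?_ hP hB hc' rfl)
    refine Finset.sum_lt_sum (fun p hp => ?_) ⟨(a, b), ?_, ?_⟩
    · simp only [Finset.mem_product, Finset.mem_Icc] at hp
      have h1 := BLE.descents (Relation.ReflTransGen.single hs) (show p.1 < p.2 by omega)
      split_ifs <;> omega
    · simp only [Finset.mem_product, Finset.mem_Icc]
      omega
    · dsimp only
      split_ifs <;> omega
  by_cases hsplit : ∃ a b, 1 ≤ a ∧ a ≤ n ∧ n < b ∧ b ≤ n + m ∧ f a = f b ∧ g b < g a
  · obtain ⟨a, b, ha, han, hb, hbm, hfab, hgab⟩ := hsplit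
    have hfa := (hf'.1 a).2 ⟨ha, by omega⟩
    have hfs := hf'.2.1 a
    have cls : ∀ v, f v = f a → v = a ∨ v = b := by
      intro v hv
      have h1 := (hf'.1 v).1 (by omega)
      by_cases h2 : v ≤ n
      · exact .inl (inj1 v a h1.1 h2 ha han hv)
      · exact .inr (inj2 v b (by omega) h1.2 hb hbm (by omega))
    set f' : ℕ → ℕ := fun v => if f v < f a ∨ v = b then f v else f v + 1 with hdef
    have lo : ∀ v, f v < f a → f' v = f v := fun v h => if_pos (.inl h)
    have fb : f' b = f a := (if_pos (.inr rfl)).trans hfab.symm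
    have fa : f' a = f a + 1 := if_neg (by omega)
    have hi : ∀ v, f a < f v → f' v = f v + 1 := fun v h => if_neg (by
      rintro (h | rfl) <;> omega)
    have tri : ∀ v, (f v < f a ∧ f' v = f v) ∨ (v = a ∧ f' v = f a + 1) ∨
        (v = b ∧ f' v = f a) ∨ (f a < f v ∧ f' v = f v + 1) := by
      intro v
      rcases lt_trichotomy (f v) (f a) with h | h | h
      · exact .inl ⟨h, lo v h⟩
      · rcases cls v h with rfl | rfl
        · exact .inr (.inl ⟨rfl, fa⟩)
        · exact .inr (.inr (.inl ⟨rfl, fb⟩))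
      · exact .inr (.inr (.inr ⟨h, hi v h⟩))
    have hP : IsPF (n + m) (s + 1) f' := by
      refine isPF_iff.2 ⟨fun v => ?_, fun v => ?_, fun k hk hks => ?_⟩
      · rw [← hf'.1 v]
        rcases tri v with h | ⟨rfl, h⟩ | ⟨rfl, h⟩ | h <;> omega
      · have := hf'.2.1 v
        rcases tri v with h | h | h | h <;> omega
      · rcases lt_trichotomy k (f a) with h | h | h
        · obtain ⟨v, hv⟩ := hf'.2.2 k hk (by omega)
          exact ⟨v, by rw [lo v (by omega), hv]⟩
        · exact ⟨b, by omega⟩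
        · by_cases h1 : k = f a + 1
          · exact ⟨a, by omega⟩
          · obtain ⟨v, hv⟩ := hf'.2.2 (k - 1) (by omega) (by omega)
            exact ⟨v, by rw [hi v (by omega)]; omega⟩
    refine step f' (s + 1) a b ha han hb hbm ⟨s + 1, f a, by omega, by omega, .inr ⟨hP, ?_, ?_⟩⟩
      hP ?_ ?_ (.inl ⟨hfab, by omega⟩)
    · intro c d hc hd
      rcases tri c with h | h | h | h <;> rcases tri d with h' | h' | h' | h' <;> omega
    · funext v
      rw [Function.comp_apply, tF_of_le ((isPF_iff.1 hP).2.1 v)]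
      rcases tri v with h | ⟨rfl, h⟩ | ⟨rfl, h⟩ | h <;> split_ifs <;> omega
    · refine blockIncr_pair_iff.2 ⟨fun c d h1 h2 h3 => ?_, fun c d h1 h2 h3 => ?_⟩
      · have := hfB.1 c d h1 h2 h3
        rcases tri c with h | ⟨rfl, h⟩ | ⟨rfl, h⟩ | h <;>
          rcases tri d with h' | ⟨rfl, h'⟩ | ⟨rfl, h'⟩ | h' <;> omega
      · have := hfB.2 c d h1 h2 h3
        rcases tri c with h | ⟨rfl, h⟩ | ⟨rfl, h⟩ | h <;>
          rcases tri d with h' | ⟨rfl, h'⟩ | ⟨rfl, h'⟩ | h' <;> omega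
    · intro c d h1 h2 h3 h4
      have := hc c d h1 h2 h3 h4
      rcases tri c with h | ⟨rfl, h⟩ | ⟨rfl, h⟩ | h <;>
        rcases tri d with h' | ⟨rfl, h'⟩ | ⟨rfl, h'⟩ | h' <;> omega
  by_cases hmerge : ∃ k a b, 1 ≤ a ∧ a ≤ n ∧ n < b ∧ b ≤ n + m ∧ f b = f a + k ∧ f a < f b ∧
      g b ≤ g a
  · classical
    obtain ⟨a, b, ha, han, hb, hbm, hk, hfab, hgab⟩ := Nat.find_spec hmerge
    have hmin : ∀ c d, 1 ≤ c → c ≤ n → n < d → d ≤ n + m → f c < f d → g d ≤ g c →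
        f b - f a ≤ f d - f c := by
      intro c d h1 h2 h3 h4 h5 h6
      have := Nat.find_min' hmerge ⟨c, d, h1, h2, h3, h4, (by omega : f d = f c + (f d - f c)),
        h5, h6⟩
      omega
    have hfa := (hf'.1 a).2 ⟨ha, by omega⟩
    have hfs := hf'.2.1 b
    have mid : ∀ v, f a ≤ f v → f v ≤ f b → v = a ∨ v = b := by
      intro v h1 h2
      have hv := (hf'.1 v).1 (by omega)
      by_contra! hne
      by_cases hvn : v ≤ n
      · have e1 := inj1 v a hv.1 hvn ha han
        have e2 := hfB.1 v a hv.1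
        have e3 := hgB.1 a v ha (by omega) hvn
        by_cases e4 : f v = f b
        · exact hsplit ⟨v, b, hv.1, hvn, hb, hbm, e4, by omega⟩
        · have := hmin v b hv.1 hvn hb hbm (by omega) (by omega)
          omega
      · have e1 := inj2 v b (by omega) hv.2 hb hbm
        have e2 := hfB.2 b v hb
        have e3 := hgB.2 v b (by omega) (by omega) hbm
        by_cases e4 : f v = f a
        · exact hsplit ⟨a, v, ha, han, by omega, hv.2, e4.symm, by omega⟩
        · have := hmin a v ha han (by omega) hv.2 (by omega) (by omega)
          omega
    have hsucc : f b = f a + 1 := by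
      by_contra hne
      obtain ⟨v, hv⟩ := hf'.2.2 (f a + 1) (by omega) (by omega)
      rcases mid v (by omega) (by omega) with rfl | rfl <;> omega
    have cla : ∀ v, f v = f a → v = a := fun v h => by
      rcases mid v (by omega) (by omega) with rfl | rfl <;> omega
    have clb : ∀ v, f v = f a + 1 → v = b := fun v h => by
      rcases mid v (by omega) (by omega) with rfl | rfl <;> omega
    have val : ∀ v, (tF s (f a) ∘ f) v = if f v ≤ f a then f v else f v - 1 :=
      fun v => tF_of_le (hf'.2.1 v)
    have hP : IsPF (n + m) (s - 1) (tF s (f a) ∘ f) := by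
      refine isPF_iff.2 ⟨fun v => ?_, fun v => ?_, fun k hk hks => ?_⟩
      · rw [← hf'.1 v, val]
        split_ifs <;> omega
      · have := hf'.2.1 v
        rw [val]
        split_ifs <;> omega
      · by_cases h : k ≤ f a
        · obtain ⟨v, hv⟩ := hf'.2.2 k hk (by omega)
          exact ⟨v, by rw [val]; split_ifs <;> omega⟩
        · obtain ⟨v, hv⟩ := hf'.2.2 (k + 1) (by omega) (by omega)
          exact ⟨v, by rw [val]; split_ifs <;> omega⟩
    refine step _ (s - 1) a b ha han hb hbm ⟨s, f a, by omega, by omega, .inl ⟨hf, ?_, rfl⟩⟩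
      hP ?_ ?_ (.inr ⟨hfab, ?_⟩)
    · intro c d h1 h2
      rw [cla c h1, clb d h2]
      omega
    · refine blockIncr_pair_iff.2 ⟨fun c d h1 h2 h3 => ?_, fun c d h1 h2 h3 => ?_⟩
      · have := hfB.1 c d h1 h2 h3
        have := clb d
        rw [val, val]
        split_ifs <;> omega
      · have := hfB.2 c d h1 h2 h3
        have := cla c
        rw [val, val]
        split_ifs <;> omega
    · intro c d h1 h2 h3 h4
      have h5 := hc c d h1 h2 h3 h4
      rw [val, val]
      by_cases h6 : f c = f a ∧ f d = f a + 1
      · obtain rfl := cla c h6.1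
        obtain rfl := clb d h6.2
        split_ifs <;> omega
      · split_ifs <;> omega
    · rw [val, val]
      split_ifs <;> omega
  · suffices f = g by rw [this]; exact Relation.ReflTransGen.refl
    have key : ∀ a b, 1 ≤ a → a ≤ n → n < b → b ≤ n + m →
        (f a < f b ↔ g a < g b) ∧ (f b < f a ↔ g b < g a) := by
      intro a b h1 h2 h3 h4
      have h5 := hc a b h1 h2 h3 h4
      have h6 : f a = f b → ¬ g b < g a := fun h h' => hsplit ⟨a, b, h1, h2, h3, h4, h, h'⟩
      have h7 : f a < f b → ¬ g b ≤ g a := fun h h' =>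
        hmerge ⟨f b - f a, a, b, h1, h2, h3, h4, by omega, h, h'⟩
      omega
    have key' : ∀ v w, 1 ≤ v → v ≤ n + m → 1 ≤ w → w ≤ n + m → (f v < f w ↔ g v < g w) := by
      intro v w h1 h2 h3 h4
      have := key v w
      have := key w v
      have := hfB.1 v w
      have := hfB.1 w v
      have := hfB.2 v w
      have := hfB.2 w v
      have := hgB.1 v w
      have := hgB.1 w v
      have := hgB.2 v w
      have := hgB.2 w v
      rcases lt_trichotomy v w with h | rfl | h
      · omega
      · simp
      · omega
    funext v
    exact le_antisymm
      (hf.le_of_strictMono hg (fun v w h1 h2 h3 h4 => (key' v w h1 h2 h3 h4).1) v)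
      (hg.le_of_strictMono hf (fun v w h1 h2 h3 h4 => (key' v w h1 h2 h3 h4).2) v)

theorem xiF_pair (n m v : ℕ) : xiF [n, m] v =
    if v = 0 then 0 else if v ≤ n then v + m else if v ≤ n + m then v - n else 0 := by
  simp only [xiF, List.sum_cons, List.sum_nil]
  split_ifs <;> omega

theorem ofList_insert {n m : ℕ} (hn : 1 ≤ n) (c v : ℕ) :
    ofList (List.range' 1 (n - 1) ++ c :: List.range' n m) v =
      if v = 0 then 0 else if v < n then v else if v = n then c
        else if v ≤ n + m then v - 1 else 0 := by
  unfold ofList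
  by_cases h0 : v = 0
  · simp [h0]
  rw [if_neg h0, if_neg h0]
  simp only [List.getD_eq_getElem?_getD]
  rcases lt_trichotomy v n with h | h | h
  · rw [List.getElem?_append_left (by simp; omega), List.getElem?_range' (by omega)]
    simp [h]
    omega
  · subst h
    rw [List.getElem?_append_right (by simp)]
    simp
  · rw [List.getElem?_append_right (by simp; omega), if_neg (by omega), if_neg (by omega)]
    obtain ⟨d, rfl⟩ := Nat.exists_eq_add_of_lt h
    have : n + d + 1 - 1 - (List.range' 1 (n - 1)).length = d + 1 := by simp; omega
    rw [this, List.getElem?_cons_succ]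
    split_ifs with h1
    · rw [List.getElem?_range' (by omega)]
      simp
    · rw [List.getElem?_eq_none (by simp; omega)]
      rfl

theorem prodF_xiF_idF (n k v : ℕ) :
    prodF (n + k) (n + k) (xiF [n, k]) (idF 1) v =
      if v = 0 then 0 else if v ≤ n then v + k else if v ≤ n + k then v - n
        else if v = n + k + 1 then v else 0 := by
  unfold prodF idF
  rw [xiF_pair]
  split_ifs <;> omega

theorem inSH_pair_iff {n m : ℕ} {γ : ℕ → ℕ} :
    InSH [n, m] γ ↔ (∃ r, IsPF (n + m) r γ) ∧ BlockIncr [n, m] γ := by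
  simp [InSH]

theorem shuffle_lt_eq_weak_interval (n m : ℕ) (hn : 1 ≤ n) (hm : 1 ≤ m) :
    {γ : ℕ → ℕ | InSH [n, m] γ ∧ γ n < γ (n + m)} =
      {γ : ℕ → ℕ | (∃ s : ℕ, IsPF (n + m) s γ) ∧
        BLE (n + m) γ (prodF (n + m - 1) (n + m - 1) (xiF [n, m - 1]) (idF 1))} := by
  set U := prodF (n + m - 1) (n + m - 1) (xiF [n, m - 1]) (idF 1) with hUdef
  have hU : ∀ v, U v = if v = 0 then 0 else if v ≤ n then v + (m - 1)
      else if v < n + m then v - n else if v = n + m then v else 0 := by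
    intro v
    rw [hUdef, show n + m - 1 = n + (m - 1) by omega, prodF_xiF_idF]
    split_ifs <;> omega
  have hUP : IsPF (n + m) (n + m) U := by
    refine isPF_iff.2 ⟨fun v => ?_, fun v => ?_, fun k hk hks => ?_⟩
    · rw [hU]; split_ifs <;> omega
    · rw [hU]; split_ifs <;> omega
    · by_cases h : k = n + m
      · exact ⟨k, by rw [hU]; split_ifs <;> omega⟩
      by_cases h : k < m
      · exact ⟨k + n, by rw [hU]; split_ifs <;> omega⟩
      · exact ⟨k - (m - 1), by rw [hU]; split_ifs <;> omega⟩
  have hUB : BlockIncr [n, m] U := by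
    refine blockIncr_pair_iff.2 ⟨fun c d h1 h2 h3 => ?_, fun c d h1 h2 h3 => ?_⟩ <;>
      rw [hU, hU] <;> split_ifs <;> omega
  ext γ
  simp only [Set.mem_ofPred_eq, inSH_pair_iff]
  constructor
  · rintro ⟨⟨⟨s, hs⟩, hB⟩, hlt⟩
    refine ⟨⟨s, hs⟩, BLE.of_cross hUP hUB hs hB fun a b h1 h2 h3 h4 => ?_⟩
    have := (blockIncr_pair_iff.1 hB).1 a n h1
    rw [hU, hU]
    by_cases hb : b = n + m
    · subst hb
      rcases eq_or_lt_of_le h2 with rfl | h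
      · split_ifs <;> omega
      · split_ifs <;> omega
    · split_ifs <;> omega
  · rintro ⟨hs, hle⟩
    refine ⟨⟨hs, hle.blockIncr hUB⟩, ?_⟩
    have h1 := (hle.descents (show n < n + m by omega)).1
    rw [hU, hU] at h1
    split_ifs at h1 <;> omega

theorem shuffle_eq_eq_weak_interval (n m : ℕ) (hn : 1 ≤ n) (hm : 1 ≤ m) :
    {γ : ℕ → ℕ | InSH [n, m] γ ∧ γ n = γ (n + m)} =
      {γ : ℕ → ℕ | (∃ s : ℕ, IsPF (n + m) s γ) ∧
        BLE (n + m) (ofList (List.range' 1 (n - 1) ++ (n + m - 1) :: List.range' n m)) γ ∧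
        BLE (n + m) γ (prodF (n + m - 2) (n + m - 2) (xiF [n - 1, m - 1]) (idF 1) ∘
          ofList (List.range' 1 (n - 1) ++ (n + m - 1) :: List.range' n m))} := by
  set Z := ofList (List.range' 1 (n - 1) ++ (n + m - 1) :: List.range' n m) with hZdef
  have hZ : ∀ v, Z v = if v = 0 then 0 else if v < n then v else if v = n then n + m - 1
      else if v ≤ n + m then v - 1 else 0 := ofList_insert hn _
  have hZP : IsPF (n + m) (n + m - 1) Z := by
    refine isPF_iff.2 ⟨fun v => ?_, fun v => ?_, fun k hk hks => ?_⟩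
    · rw [hZ]; split_ifs <;> omega
    · rw [hZ]; split_ifs <;> omega
    · by_cases h : k < n
      · exact ⟨k, by rw [hZ]; split_ifs <;> omega⟩
      · exact ⟨k + 1, by rw [hZ, if_neg, if_neg, if_neg, if_pos] <;> omega⟩
  have hZB : BlockIncr [n, m] Z := by
    refine blockIncr_pair_iff.2 ⟨fun c d h1 h2 h3 => ?_, fun c d h1 h2 h3 => ?_⟩ <;>
      rw [hZ, hZ] <;> split_ifs <;> omega
  set U := prodF (n + m - 2) (n + m - 2) (xiF [n - 1, m - 1]) (idF 1) ∘ Z with hUdef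
  have hU : ∀ v, U v = if v = 0 then 0 else if v ≤ n then v + (m - 1)
      else if v < n + m then v - n else if v = n + m then n + m - 1 else 0 := by
    intro v
    rw [hUdef, Function.comp_apply, hZ, show n + m - 2 = (n - 1) + (m - 1) by omega,
      prodF_xiF_idF]
    split_ifs <;> omega
  have hUP : IsPF (n + m) (n + m - 1) U := by
    refine isPF_iff.2 ⟨fun v => ?_, fun v => ?_, fun k hk hks => ?_⟩
    · rw [hU]; split_ifs <;> omega
    · rw [hU]; split_ifs <;> omega
    · by_cases h : k < m
      · exact ⟨k + n, by rw [hU]; split_ifs <;> omega⟩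
      · exact ⟨k - (m - 1), by rw [hU]; split_ifs <;> omega⟩
  have hUB : BlockIncr [n, m] U := by
    refine blockIncr_pair_iff.2 ⟨fun c d h1 h2 h3 => ?_, fun c d h1 h2 h3 => ?_⟩ <;>
      rw [hU, hU] <;> split_ifs <;> omega
  ext γ
  simp only [Set.mem_ofPred_eq, inSH_pair_iff]
  constructor
  · rintro ⟨⟨⟨s, hs⟩, hB⟩, heq⟩
    refine ⟨⟨s, hs⟩, BLE.of_cross hs hB hZP hZB fun a b h1 h2 h3 h4 => ?_,
      BLE.of_cross hUP hUB hs hB fun a b h1 h2 h3 h4 => ?_⟩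
    · have h5 := (blockIncr_pair_iff.1 hB).2 b (n + m) h3
      rw [hZ, hZ]
      rcases eq_or_lt_of_le h2 with rfl | h
      · rcases eq_or_lt_of_le h4 with rfl | h
        · split_ifs <;> omega
        · split_ifs <;> omega
      · split_ifs <;> omega
    · have := (blockIncr_pair_iff.1 hB).1 a n h1
      rw [hU, hU]
      rcases eq_or_lt_of_le h2 with rfl | h
      · rcases eq_or_lt_of_le h4 with rfl | h
        · split_ifs <;> omega
        · split_ifs <;> omega
      · rcases eq_or_lt_of_le h4 with rfl | h
        · split_ifs <;> omega
        · split_ifs <;> omega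
  · rintro ⟨hs, hle, hle'⟩
    refine ⟨⟨hs, hle'.blockIncr hUB⟩, ?_⟩
    have e1 : Z n = n + m - 1 := by rw [hZ]; split_ifs <;> omega
    have e2 : Z (n + m) = n + m - 1 := by rw [hZ]; split_ifs <;> omega
    have e3 : U n = n + m - 1 := by rw [hU]; split_ifs <;> omega
    have e4 : U (n + m) = n + m - 1 := by rw [hU]; split_ifs <;> omega
    have h1 := (hle.descents (show n < n + m by omega)).1
    have h2 := (hle'.descents (show n < n + m by omega)).2
    omega

theorem shuffle_gt_eq_weak_interval (n m : ℕ) (hn : 1 ≤ n) (hm : 1 ≤ m) :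
    {γ : ℕ → ℕ | InSH [n, m] γ ∧ γ (n + m) < γ n} =
      {γ : ℕ → ℕ | (∃ s : ℕ, IsPF (n + m) s γ) ∧
        BLE (n + m) (ofList (List.range' 1 (n - 1) ++ (n + m) :: List.range' n m)) γ ∧
        BLE (n + m) γ (xiF [n, m])} := by
  set Z := ofList (List.range' 1 (n - 1) ++ (n + m) :: List.range' n m) with hZdef
  have hZ : ∀ v, Z v = if v = 0 then 0 else if v < n then v else if v = n then n + m
      else if v ≤ n + m then v - 1 else 0 := ofList_insert hn _
  have hZP : IsPF (n + m) (n + m) Z := by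
    refine isPF_iff.2 ⟨fun v => ?_, fun v => ?_, fun k hk hks => ?_⟩
    · rw [hZ]; split_ifs <;> omega
    · rw [hZ]; split_ifs <;> omega
    · by_cases h : k < n
      · exact ⟨k, by rw [hZ]; split_ifs <;> omega⟩
      by_cases h : k = n + m
      · exact ⟨n, by rw [hZ]; split_ifs <;> omega⟩
      · exact ⟨k + 1, by rw [hZ, if_neg, if_neg, if_neg, if_pos] <;> omega⟩
  have hZB : BlockIncr [n, m] Z := by
    refine blockIncr_pair_iff.2 ⟨fun c d h1 h2 h3 => ?_, fun c d h1 h2 h3 => ?_⟩ <;>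
      rw [hZ, hZ] <;> split_ifs <;> omega
  have hUP : IsPF (n + m) (n + m) (xiF [n, m]) := by
    refine isPF_iff.2 ⟨fun v => ?_, fun v => ?_, fun k hk hks => ?_⟩
    · rw [xiF_pair]; split_ifs <;> omega
    · rw [xiF_pair]; split_ifs <;> omega
    · by_cases h : k ≤ m
      · exact ⟨k + n, by rw [xiF_pair]; split_ifs <;> omega⟩
      · exact ⟨k - m, by rw [xiF_pair]; split_ifs <;> omega⟩
  have hUB : BlockIncr [n, m] (xiF [n, m]) := by
    refine blockIncr_pair_iff.2 ⟨fun c d h1 h2 h3 => ?_, fun c d h1 h2 h3 => ?_⟩ <;>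
      rw [xiF_pair, xiF_pair] <;> split_ifs <;> omega
  ext γ
  simp only [Set.mem_ofPred_eq, inSH_pair_iff]
  constructor
  · rintro ⟨⟨⟨s, hs⟩, hB⟩, hlt⟩
    refine ⟨⟨s, hs⟩, BLE.of_cross hs hB hZP hZB fun a b h1 h2 h3 h4 => ?_,
      BLE.of_cross hUP hUB hs hB fun a b h1 h2 h3 h4 => ?_⟩
    · have h5 := (blockIncr_pair_iff.1 hB).2 b (n + m) h3
      rw [hZ, hZ]
      rcases eq_or_lt_of_le h2 with rfl | h
      · rcases eq_or_lt_of_le h4 with rfl | h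
        · split_ifs <;> omega
        · split_ifs <;> omega
      · split_ifs <;> omega
    · rw [xiF_pair, xiF_pair]
      split_ifs <;> omega
  · rintro ⟨hs, hle, hle'⟩
    refine ⟨⟨hs, hle'.blockIncr hUB⟩, ?_⟩
    have h1 := (hle.descents (show n < n + m by omega)).2
    rw [hZ, hZ] at h1
    split_ifs at h1 <;> omega

/-- description of `SH^≻(n,m)`, `SH^•(n,m)` and `SH^≺(n,m)` as weak Bruhat
intervals in `P_{n+m}`, where
`z(n-1,m-1,0) = (1,…,n-1, n+m-1, n,…,n+m-1)` and `z(n-1,m) = (1,…,n-1, n+m, n,…,n+m-1)`. -/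
theorem shuffle_parts_eq_weak_intervals (n m : ℕ) (hn : 1 ≤ n) (hm : 1 ≤ m) :
    ({γ : ℕ → ℕ | InSH [n, m] γ ∧ γ n < γ (n + m)} =
      {γ : ℕ → ℕ | (∃ s : ℕ, IsPF (n + m) s γ) ∧
        BLE (n + m) γ (prodF (n + m - 1) (n + m - 1) (xiF [n, m - 1]) (idF 1))}) ∧
    ({γ : ℕ → ℕ | InSH [n, m] γ ∧ γ n = γ (n + m)} =
      {γ : ℕ → ℕ | (∃ s : ℕ, IsPF (n + m) s γ) ∧
        BLE (n + m) (ofList (List.range' 1 (n - 1) ++ (n + m - 1) :: List.range' n m)) γ ∧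
        BLE (n + m) γ (prodF (n + m - 2) (n + m - 2) (xiF [n - 1, m - 1]) (idF 1) ∘
          ofList (List.range' 1 (n - 1) ++ (n + m - 1) :: List.range' n m))}) ∧
    ({γ : ℕ → ℕ | InSH [n, m] γ ∧ γ (n + m) < γ n} =
      {γ : ℕ → ℕ | (∃ s : ℕ, IsPF (n + m) s γ) ∧
        BLE (n + m) (ofList (List.range' 1 (n - 1) ++ (n + m) :: List.range' n m)) γ ∧
        BLE (n + m) γ (xiF [n, m])}) := by
  exact ⟨shuffle_lt_eq_weak_interval n m hn hm,
    shuffle_eq_eq_weak_interval n m hn hm,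
    shuffle_gt_eq_weak_interval n m hn hm⟩

end PaperP
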